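/- arXiv:2409.01929 — 3 statements merged into one kernel-verified Lean document; each statement's English description precedes it below -/
import Mathlib

section
/- Suppose 𝔽_q = 𝔽_2 and x(x+1) divides the nonconstant monic polynomial f ∈ 𝔽_2[x]. Let D = {f_1, …, f_k} be a set of monic proper divisors of f and let D̄ = {gcd(f_i, x(x+1)) : 1 ≤ i ≤ k}. Then the gcd-graph G_f(D) is connected if and only if gcd(f_1, f_2, …, f_k) = 1 and D̄ contains at least two elements different from x(x+1), i.e. |D̄ \ {x(x+1)}| ≥ 2. -/
open Polynomial

variable {Fq : Type} [Field Fq] [Fintype Fq] [DecidableEq Fq]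

/-- The gcd-graph `G_f(D)`: vertices are `𝔽_q[x]/(f)`, and two distinct vertices are adjacent
iff the (monic, normalized) gcd of a representative of their difference with `f` lies in `D`. -/
def gcdGraph (f : Polynomial Fq) (D : Finset (Polynomial Fq)) :
    SimpleGraph (AdjoinRoot f) :=
  SimpleGraph.fromRel fun u v =>
    ∃ p : Polynomial Fq, AdjoinRoot.mk f p = u - v ∧ gcd p f ∈ D

/-- The connection set of the gcd-graph: the residue classes whose gcd with `f` lies in `D`. -/
def gcdConnectionSet {K : Type} [Field K] [DecidableEq K] (f : K[X]) (D : Finset K[X]) :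
    Set (AdjoinRoot f) :=
  {s | ∃ p : K[X], AdjoinRoot.mk f p = s ∧ gcd p f ∈ D}

theorem gcdGraph_reachable_add {K : Type} [Field K] [DecidableEq K] (f : K[X]) (D : Finset K[X])
    {s : AdjoinRoot f} (hs : s ∈ AddSubgroup.closure (gcdConnectionSet f D)) :
    ∀ u, (gcdGraph f D).Reachable (u + s) u := by
  induction hs using AddSubgroup.closure_induction with
  | mem x hx =>
    intro u
    by_cases h0 : x = 0
    · simp [h0]
    · refine SimpleGraph.Adj.reachable ?_
      rw [gcdGraph, SimpleGraph.fromRel_adj]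
      refine ⟨by simpa using h0, Or.inl ?_⟩
      rw [add_sub_cancel_left]
      exact hx
  | zero => intro u; simp
  | add x y _ _ ihx ihy =>
    intro u
    rw [← add_assoc]
    exact (ihy _).trans (ihx u)
  | neg x _ ih =>
    intro u
    simpa using (ih (u + -x)).symm

theorem gcdGraph_connected_iff_closure_eq_top {K : Type} [Field K] [DecidableEq K] (f : K[X])
    (D : Finset K[X]) :
    (gcdGraph f D).Connected ↔ AddSubgroup.closure (gcdConnectionSet f D) = ⊤ := by
  constructor
  · intro h
    refine (AddSubgroup.eq_top_iff' _).2 fun x => ?_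
    have hr := (SimpleGraph.reachable_iff_reflTransGen _ _).1 (h.preconnected 0 x)
    induction hr with
    | refl => exact zero_mem _
    | @tail b c _ hbc ih =>
      rw [gcdGraph, SimpleGraph.fromRel_adj] at hbc
      rcases hbc.2 with hs | hs
      · simpa using sub_mem ih (AddSubgroup.subset_closure hs)
      · simpa using add_mem ih (AddSubgroup.subset_closure hs)
  · intro h
    refine { preconnected := fun u v => ?_, nonempty := ⟨0⟩ }
    simpa using gcdGraph_reachable_add f D (s := u - v) (by rw [h]; trivial) v

theorem exists_isCoprime_and_isCoprime_sub {g r : (ZMod 2)[X]} (hg : g ≠ 0)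
    (hr : X * (X + 1) ∣ r) : ∃ u, IsCoprime u g ∧ IsCoprime (r - u) g := by
  induction g using UniqueFactorizationMonoid.induction_on_coprime with
  | h0 => exact absurd rfl hg
  | @h1 x hx => exact ⟨1, isCoprime_one_left,
      isCoprime_comm.1 (isCoprime_one_left.of_isCoprime_of_dvd_left hx.dvd)⟩
  | @hpr p i hp =>
    suffices h : ∃ u, ¬ p ∣ u ∧ ¬ p ∣ r - u by
      obtain ⟨u, h1, h2⟩ := h
      exact ⟨u, ((hp.irreducible.coprime_iff_not_dvd.2 h1).symm).pow_right,
        ((hp.irreducible.coprime_iff_not_dvd.2 h2).symm).pow_right⟩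
    have h1 : ¬ p ∣ 1 := hp.not_dvd_one
    by_cases hpr : p ∣ r - 1
    · have hpX : ¬ p ∣ X * (X + 1) := fun h =>
        h1 (by simpa using dvd_sub (h.trans hr) hpr)
      refine ⟨X, fun h => hpX (h.mul_right _), fun h => hpX (Dvd.dvd.mul_left ?_ _)⟩
      have h2 : X + 1 = (r - 1) - (r - X) := by
        rw [sub_sub_sub_cancel_left, CharTwo.sub_eq_add]
      rw [h2]
      exact dvd_sub hpr h
    · exact ⟨1, h1, hpr⟩
  | @hcp a b hab iha ihb =>
    obtain ⟨u, hu, hu'⟩ := iha (left_ne_zero_of_mul hg)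
    obtain ⟨v, hv, hv'⟩ := ihb (right_ne_zero_of_mul hg)
    obtain ⟨s, t, hst⟩ := hab.isCoprime
    have ha : u * (t * b) + v * (s * a) = u + a * (s * (v - u)) := by
      linear_combination u * hst
    have hb : u * (t * b) + v * (s * a) = v + b * (t * (u - v)) := by
      linear_combination v * hst
    refine ⟨u * (t * b) + v * (s * a), IsCoprime.mul_right ?_ ?_, IsCoprime.mul_right ?_ ?_⟩
    · rw [ha]; exact hu.add_mul_left_left _
    · rw [hb]; exact hv.add_mul_left_left _
    · rw [ha, ← sub_sub, sub_eq_add_neg, ← mul_neg]; exact hu'.add_mul_left_left _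
    · rw [hb, ← sub_sub, sub_eq_add_neg, ← mul_neg]; exact hv'.add_mul_left_left _

theorem X_mul_X_add_one_dvd_iff {p : (ZMod 2)[X]} :
    X * (X + 1) ∣ p ↔ p.eval 0 = 0 ∧ p.eval 1 = 0 := by
  have h0 : X ∣ p ↔ p.eval 0 = 0 := by
    simpa using dvd_iff_isRoot (p := p) (a := 0)
  have h1 : X + 1 ∣ p ↔ p.eval 1 = 0 := by
    rw [← CharTwo.sub_eq_add]
    simpa using dvd_iff_isRoot (p := p) (a := 1)
  have hc : IsCoprime (X : (ZMod 2)[X]) (X + 1) := ⟨-1, 1, by ring⟩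
  rw [← h0, ← h1]
  exact ⟨fun h => ⟨dvd_of_mul_right_dvd h, dvd_of_mul_left_dvd h⟩, fun h => hc.mul_dvd h.1 h.2⟩

theorem gcd_eq_gcd_of_dvd_sub {K : Type*} [Field K] [DecidableEq K] {a b c : K[X]}
    (h : c ∣ a - b) : gcd a c = gcd b c := by
  apply dvd_antisymm_of_normalize_eq (normalize_gcd _ _) (normalize_gcd _ _)
  · refine dvd_gcd ?_ (gcd_dvd_right _ _)
    simpa using dvd_sub (gcd_dvd_left a c) ((gcd_dvd_right a c).trans h)
  · refine dvd_gcd ?_ (gcd_dvd_right _ _)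
    simpa using dvd_add ((gcd_dvd_right b c).trans h) (gcd_dvd_left b c)

/-- The gcd with `X * (X + 1)` over `𝔽_2` records exactly the values at `0` and `1`. -/
theorem gcd_X_mul_X_add_one_eq_iff {a b : (ZMod 2)[X]} :
    gcd a (X * (X + 1)) = gcd b (X * (X + 1)) ↔
      a.eval 0 = b.eval 0 ∧ a.eval 1 = b.eval 1 := by
  constructor
  · have key : ∀ c x : ZMod 2, ∀ p : (ZMod 2)[X], X - C c ∣ X * (X + 1) →
        (p.eval c = 0 ↔ X - C c ∣ gcd p (X * (X + 1))) := fun c _ p hc => by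
      rw [dvd_gcd_iff, and_iff_left hc, dvd_iff_isRoot, IsRoot.def]
    have two : ∀ s t : ZMod 2, (s = 0 ↔ t = 0) → s = t := by decide
    intro h
    refine ⟨two _ _ ?_, two _ _ ?_⟩
    · have h0 : (X - C 0 : (ZMod 2)[X]) ∣ X * (X + 1) := by simp
      rw [key 0 0 a h0, key 0 0 b h0, h]
    · have h1 : (X - C 1 : (ZMod 2)[X]) ∣ X * (X + 1) := by
        rw [map_one, CharTwo.sub_eq_add]; exact dvd_mul_left _ _
      rw [key 1 0 a h1, key 1 0 b h1, h]
  · rintro ⟨h0, h1⟩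
    exact gcd_eq_gcd_of_dvd_sub (X_mul_X_add_one_dvd_iff.2 (by simp [h0, h1]))

theorem gcd_X_mul_X_add_one_eq_self_iff {a : (ZMod 2)[X]} :
    gcd a (X * (X + 1)) = X * (X + 1) ↔ a.eval 0 = 0 ∧ a.eval 1 = 0 := by
  have hm : normalize (X * (X + 1) : (ZMod 2)[X]) = X * (X + 1) :=
    (monic_X.mul (monic_X_add_C 1)).normalize_eq_self
  rw [gcd_eq_right_iff _ _ hm, X_mul_X_add_one_dvd_iff]

theorem exists_mem_map_ne_zero_of_closure_eq_top {A B : Type*} [AddGroup A] [AddGroup B]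
    {S : Set A} (hS : AddSubgroup.closure S = ⊤) (φ : A →+ B) {x : A} (hx : φ x ≠ 0) :
    ∃ s ∈ S, φ s ≠ 0 := by
  by_contra! h
  have hle : AddSubgroup.closure S ≤ φ.ker := (AddSubgroup.closure_le _).2 h
  rw [hS] at hle
  exact hx (hle (AddSubgroup.mem_top x))

theorem mk_gcd_dvd_of_mem_closure {K : Type} [Field K] [DecidableEq K] {f : K[X]}
    {D : Finset K[X]} {x : AdjoinRoot f}
    (hx : x ∈ AddSubgroup.closure (gcdConnectionSet f D)) :
    AdjoinRoot.mk f (D.gcd id) ∣ x := by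
  induction hx using AddSubgroup.closure_induction with
  | mem x hx =>
    obtain ⟨p, rfl, hp⟩ := hx
    have hdvd : D.gcd id ∣ p := (Finset.gcd_dvd hp).trans (gcd_dvd_left p f)
    exact map_dvd (AdjoinRoot.mk f) hdvd
  | zero => exact dvd_zero _
  | add x y _ _ hx hy => exact dvd_add hx hy
  | neg x _ hx =>
    obtain ⟨y, rfl⟩ := hx
    exact ⟨-y, (mul_neg _ _).symm⟩

theorem gcd_id_eq_one_of_closure_eq_top {K : Type} [Field K] [DecidableEq K] {f : K[X]}
    (hf : f.Monic) (hdeg : 0 < f.natDegree) {D : Finset K[X]} (hD : ∀ d ∈ D, d ∣ f)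
    (h : AddSubgroup.closure (gcdConnectionSet f D) = ⊤) : D.gcd id = 1 := by
  have hgf : D.gcd id ∣ f := by
    obtain ⟨s, p, -, hp⟩ : (gcdConnectionSet f D).Nonempty := by
      rw [Set.nonempty_iff_ne_empty]
      intro he
      have : Nontrivial (AdjoinRoot f) := AdjoinRoot.nontrivial f
        (by rw [degree_eq_natDegree hf.ne_zero]; exact_mod_cast hdeg.ne')
      rw [he, AddSubgroup.closure_empty] at h
      exact bot_ne_top h
    exact (Finset.gcd_dvd hp).trans (hD _ hp)
  obtain ⟨w, hw⟩ := mk_gcd_dvd_of_mem_closure (h ▸ AddSubgroup.mem_top (1 : AdjoinRoot f))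
  obtain ⟨q, rfl⟩ := AdjoinRoot.mk_surjective w
  have hsub : f ∣ 1 - D.gcd id * q := by
    rw [← AdjoinRoot.mk_eq_mk, map_one, map_mul]
    exact hw
  have hu : IsUnit (D.gcd id) :=
    isUnit_of_dvd_one ((dvd_sub_left (dvd_mul_right _ q)).1 (hgf.trans hsub))
  rw [← Finset.normalize_gcd]
  exact normalize_eq_one.2 hu

/-- Evaluation at a root of `f`, on the quotient by `f`. -/
noncomputable def adjoinRootEval {K : Type*} [Field K] {f : K[X]} {c : K} (hc : f.eval c = 0) :
    AdjoinRoot f →+ K :=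
  (AdjoinRoot.lift (RingHom.id K) c (by simpa [eval₂_id] using hc)).toAddMonoidHom

theorem adjoinRootEval_mk {K : Type*} [Field K] {f : K[X]} {c : K} (hc : f.eval c = 0)
    (p : K[X]) : adjoinRootEval hc (AdjoinRoot.mk f p) = p.eval c := by
  simp [adjoinRootEval, eval₂_id]

theorem two_le_card_of_closure_eq_top {f : (ZMod 2)[X]} (hxx : X * (X + 1) ∣ f)
    {D : Finset (ZMod 2)[X]} (h : AddSubgroup.closure (gcdConnectionSet f D) = ⊤) :
    2 ≤ ((D.image fun d => gcd d (X * (X + 1))) \ {X * (X + 1)}).card := by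
  obtain ⟨hf0, hf1⟩ := X_mul_X_add_one_dvd_iff.1 hxx
  have eval_gcd (p : (ZMod 2)[X]) :
      (gcd p f).eval 0 = p.eval 0 ∧ (gcd p f).eval 1 = p.eval 1 := by
    rw [← gcd_X_mul_X_add_one_eq_iff, gcd_assoc, gcd_eq_right_iff f (X * (X + 1))
      (monic_X.mul (monic_X_add_C 1)).normalize_eq_self |>.2 hxx]
  have key (φ : AdjoinRoot f →+ ZMod 2) (x : AdjoinRoot f) (hx : φ x ≠ 0) :
      ∃ d ∈ D, ∃ p, φ (AdjoinRoot.mk f p) ≠ 0 ∧ d.eval 0 = p.eval 0 ∧ d.eval 1 = p.eval 1 := by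
    obtain ⟨_, ⟨p, rfl, hp⟩, hne⟩ := exists_mem_map_ne_zero_of_closure_eq_top h φ hx
    exact ⟨_, hp, p, hne, eval_gcd p⟩
  obtain ⟨d₀, hd₀, p₀, hp₀, h₀, h₀'⟩ := key (adjoinRootEval hf0) 1 (by
    rw [← map_one (AdjoinRoot.mk f), adjoinRootEval_mk]; simp)
  obtain ⟨d₁, hd₁, p₁, hp₁, h₁, h₁'⟩ := key (adjoinRootEval hf1) 1 (by
    rw [← map_one (AdjoinRoot.mk f), adjoinRootEval_mk]; simp)
  obtain ⟨d₂, hd₂, p₂, hp₂, h₂, h₂'⟩ := key (adjoinRootEval hf0 + adjoinRootEval hf1)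
    (AdjoinRoot.mk f X) (by
      rw [AddMonoidHom.add_apply, adjoinRootEval_mk, adjoinRootEval_mk]; simp)
  rw [AddMonoidHom.add_apply, adjoinRootEval_mk, adjoinRootEval_mk, ← h₂, ← h₂'] at hp₂
  rw [adjoinRootEval_mk, ← h₀] at hp₀
  rw [adjoinRootEval_mk, ← h₁'] at hp₁
  have hmem (d : (ZMod 2)[X]) (hd : d ∈ D) (hne : ¬ (d.eval 0 = 0 ∧ d.eval 1 = 0)) :
      gcd d (X * (X + 1)) ∈ (D.image fun d => gcd d (X * (X + 1))) \ {X * (X + 1)} := by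
    rw [Finset.mem_sdiff, Finset.mem_singleton, gcd_X_mul_X_add_one_eq_self_iff]
    exact ⟨Finset.mem_image_of_mem _ hd, hne⟩
  by_contra! hlt
  have hone := Finset.card_le_one.1 (Nat.le_of_lt_succ hlt)
  have m₀ := hmem d₀ hd₀ fun h => hp₀ h.1
  have m₁ := hmem d₁ hd₁ fun h => hp₁ h.2
  have m₂ := hmem d₂ hd₂ fun h => hp₂ (by simp [h.1, h.2])
  have e₀ := gcd_X_mul_X_add_one_eq_iff.1 (hone _ m₀ _ m₂)
  have e₁ := gcd_X_mul_X_add_one_eq_iff.1 (hone _ m₁ _ m₂)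
  rw [e₀.1] at hp₀
  rw [e₁.2] at hp₁
  have two : ∀ s t : ZMod 2, s ≠ 0 → t ≠ 0 → s + t = 0 := by decide
  exact hp₂ (two _ _ hp₀ hp₁)

theorem mk_mul_mem_gcdConnectionSet {K : Type} [Field K] [DecidableEq K] {f d u : K[X]}
    {D : Finset K[X]} (hd : d ∈ D) (hm : d.Monic) {g : K[X]} (hg : f = d * g) (hu : IsCoprime u g) :
    AdjoinRoot.mk f (d * u) ∈ gcdConnectionSet f D := by
  refine ⟨d * u, rfl, ?_⟩
  have h1 : gcd u g = 1 := by
    rw [← normalize_gcd]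
    exact normalize_eq_one.2 ((gcd_isUnit_iff u g).2 hu)
  rwa [hg, gcd_mul_left, h1, mul_one, hm.normalize_eq_self]

theorem span_eq_top_of_gcd_eq_one {K : Type*} [Field K] [DecidableEq K] {D : Finset K[X]}
    (h : D.gcd id = 1) : Ideal.span (D : Set K[X]) = ⊤ := by
  rw [← Ideal.span_singleton_generator (Ideal.span (D : Set K[X])), Ideal.span_singleton_eq_top]
  refine isUnit_of_dvd_one (h ▸ Finset.dvd_gcd fun d hd => ?_)
  exact (Submodule.IsPrincipal.mem_iff_generator_dvd _).1 (Ideal.subset_span hd)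

theorem mk_mem_closure_of_X_mul_X_add_one_dvd {f : (ZMod 2)[X]} (hf : f ≠ 0)
    {D : Finset (ZMod 2)[X]} (hD : ∀ d ∈ D, d.Monic ∧ d ∣ f) (hgcd : D.gcd id = 1)
    {p : (ZMod 2)[X]} (hp : X * (X + 1) ∣ p) :
    AdjoinRoot.mk f p ∈ AddSubgroup.closure (gcdConnectionSet f D) := by
  suffices h : ∀ a ∈ Ideal.span (D : Set (ZMod 2)[X]), ∀ q, X * (X + 1) ∣ q →
      AdjoinRoot.mk f (a * q) ∈ AddSubgroup.closure (gcdConnectionSet f D) by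
    simpa using h 1 (span_eq_top_of_gcd_eq_one hgcd ▸ Submodule.mem_top) p hp
  intro a ha
  induction ha using Submodule.span_induction with
  | mem d hd =>
    intro q hq
    obtain ⟨hm, g, hg⟩ := hD d hd
    obtain ⟨u, hu, hu'⟩ := exists_isCoprime_and_isCoprime_sub
      (right_ne_zero_of_mul (hg ▸ hf)) hq
    have := add_mem
      (AddSubgroup.subset_closure (mk_mul_mem_gcdConnectionSet hd hm hg hu))
      (AddSubgroup.subset_closure (mk_mul_mem_gcdConnectionSet hd hm hg hu'))
    rwa [← map_add, ← mul_add, add_sub_cancel] at this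
  | zero => intro q _; simp
  | add x y _ _ ihx ihy =>
    intro q hq
    rw [add_mul, map_add]
    exact add_mem (ihx q hq) (ihy q hq)
  | smul c x _ ih =>
    intro q hq
    rw [smul_eq_mul, mul_comm c, mul_assoc]
    exact ih _ (hq.mul_left c)

theorem closure_eq_top_of_gcd_eq_one_of_two_le_card {f : (ZMod 2)[X]} (hf : f ≠ 0)
    {D : Finset (ZMod 2)[X]} (hD : ∀ d ∈ D, d.Monic ∧ d ∣ f) (hgcd : D.gcd id = 1)
    (hcard : 2 ≤ ((D.image fun d => gcd d (X * (X + 1))) \ {X * (X + 1)}).card) :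
    AddSubgroup.closure (gcdConnectionSet f D) = ⊤ := by
  obtain ⟨_, ha, _, hb, hab⟩ := Finset.one_lt_card.1 hcard
  simp only [Finset.mem_sdiff, Finset.mem_image, Finset.mem_singleton] at ha hb
  obtain ⟨⟨a, haD, rfl⟩, ha⟩ := ha
  obtain ⟨⟨b, hbD, rfl⟩, hb⟩ := hb
  rw [gcd_X_mul_X_add_one_eq_self_iff] at ha hb
  rw [Ne, gcd_X_mul_X_add_one_eq_iff] at hab
  have hmem (d : (ZMod 2)[X]) (hd : d ∈ D) (s : ZMod 2) :
      AdjoinRoot.mk f (C s * d) ∈ AddSubgroup.closure (gcdConnectionSet f D) := by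
    obtain ⟨hm, g, hg⟩ := hD d hd
    have h1 := mk_mul_mem_gcdConnectionSet hd hm hg isCoprime_one_left
    rw [mul_one] at h1
    obtain rfl | rfl : s = 0 ∨ s = 1 := by decide +revert
    · simp
    · simpa using AddSubgroup.subset_closure h1
  refine (AddSubgroup.eq_top_iff' _).2 fun x => ?_
  obtain ⟨p, rfl⟩ := AdjoinRoot.mk_surjective x
  have comb : ∀ a₀ a₁ b₀ b₁ : ZMod 2, ¬ (a₀ = 0 ∧ a₁ = 0) → ¬ (b₀ = 0 ∧ b₁ = 0) →
      ¬ (a₀ = b₀ ∧ a₁ = b₁) → ∀ p₀ p₁ : ZMod 2, ∃ s t : ZMod 2,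
        p₀ = s * a₀ + t * b₀ ∧ p₁ = s * a₁ + t * b₁ := by decide
  obtain ⟨s, t, h0, h1⟩ := comb _ _ _ _ ha hb hab (p.eval 0) (p.eval 1)
  have hdvd : X * (X + 1) ∣ p - (C s * a + C t * b) :=
    X_mul_X_add_one_dvd_iff.2 (by simp [h0, h1])
  have := add_mem (mk_mem_closure_of_X_mul_X_add_one_dvd hf hD hgcd hdvd)
    (add_mem (hmem a haD s) (hmem b hbD t))
  rwa [← map_add, ← map_add, sub_add_cancel] at this

/-- Over `𝔽_2`, with `x(x+1) ∣ f`: the gcd-graph `G_f(D)` is connected iff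
`gcd(f_1, …, f_k) = 1` and `D̄ = {gcd(f_i, x(x+1))}` contains at least two elements
different from `x(x+1)`. -/
theorem gcdGraph_connected_iff_of_X_mul_X_add_one_dvd
    (f : Polynomial (ZMod 2)) (hf : f.Monic) (hdeg : 0 < f.natDegree)
    (hxx : X * (X + 1) ∣ f)
    (D : Finset (Polynomial (ZMod 2))) (hD : ∀ d ∈ D, d.Monic ∧ d ∣ f ∧ d ≠ f) :
    (gcdGraph f D).Connected ↔
      D.gcd id = 1 ∧
        2 ≤ ((D.image fun d => gcd d (X * (X + 1))) \ {X * (X + 1)}).card := by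
  rw [gcdGraph_connected_iff_closure_eq_top]
  exact ⟨fun h => ⟨gcd_id_eq_one_of_closure_eq_top hf hdeg (fun d hd => (hD d hd).2.1) h,
      two_le_card_of_closure_eq_top hxx h⟩,
    fun h => closure_eq_top_of_gcd_eq_one_of_two_le_card hf.ne_zero
      (fun d hd => ⟨(hD d hd).1, (hD d hd).2.1⟩) h.1 h.2⟩
end

section
/- Let 𝔽_q have characteristic p, let f ∈ 𝔽_q[x] be a nonconstant monic polynomial, let g ∈ 𝔽_q[x] be monic, and let ψ : 𝔽_q[x]/(f) → 𝔽_q be any non-degenerate 𝔽_q-linear functional. Set t = f / gcd(f, g). Then the Ramanujan sum satisfies c_ψ(g, f) = μ(t) · φ(f)/φ(t), where φ(h) denotes the order of the unit group (𝔽_q[x]/(h))^×. In particular c_ψ(g, f) is an integer independent of the choice of ψ. -/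
open Polynomial

variable {Fq : Type} [Field Fq] [Fintype Fq] [DecidableEq Fq]

/-- `ω(h)`: the number of distinct monic irreducible factors of `h`. -/
noncomputable def omegaPoly (h : Polynomial Fq) : ℕ :=
  Nat.card {π : Polynomial Fq // π.Monic ∧ Irreducible π ∧ π ∣ h}

open Classical in
/-- The Möbius function of a monic polynomial: `0` if not squarefree,
`(−1)^{ω(h)}` if squarefree. -/
noncomputable def muPoly (h : Polynomial Fq) : ℤ :=
  if Squarefree h then (-1) ^ omegaPoly h else 0

/-- `φ(h)`: the order of the unit group of `𝔽_q[x]/(h)`. -/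
noncomputable def phiPoly (h : Polynomial Fq) : ℕ :=
  Nat.card (AdjoinRoot h)ˣ

/-- An additive character that is nontrivial on the ideal `I` sums to zero over `I`. -/
lemma AddChar.sum_indicator_ideal {R : Type*} [CommRing R] [Fintype R] (χ : AddChar R ℂ)
    (I : Ideal R) (hI : ∃ a ∈ I, χ a ≠ 1) [DecidablePred (· ∈ I)] :
    ∑ a : R, (if a ∈ I then χ a else 0) = 0 := by
  obtain ⟨b, hb, hχb⟩ := hI
  have key : χ b * ∑ a : R, (if a ∈ I then χ a else 0) =
      ∑ a : R, (if a ∈ I then χ a else 0) := by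
    rw [Finset.mul_sum]
    refine Fintype.sum_equiv (Equiv.addLeft b) _ _ fun a => ?_
    simp only [Equiv.coe_addLeft, I.add_mem_iff_right hb, mul_ite, mul_zero,
      AddChar.map_add_eq_mul]
  by_contra h
  exact hχb (mul_right_cancel₀ h (by rw [key, one_mul]))

open Classical in
/-- Inclusion-exclusion over maximal ideals for the indicator of the units. -/
lemma ite_isUnit_eq_sum {R : Type*} [CommRing R] [Fintype (MaximalSpectrum R)] (a : R)
    [Decidable (IsUnit a)] :
    (if IsUnit a then (1 : ℂ) else 0) =
      ∑ S : Finset (MaximalSpectrum R),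
        (-1) ^ S.card * (if a ∈ S.inf MaximalSpectrum.asIdeal then 1 else 0) := by
  have hprod : (if IsUnit a then (1 : ℂ) else 0) =
      ∏ m : MaximalSpectrum R, (1 + if a ∈ m.asIdeal then (-1) else 0) := by
    split_ifs with h
    · refine (Finset.prod_eq_one fun m _ => ?_).symm
      have : a ∉ m.asIdeal := fun hm => m.isMaximal.ne_top (Ideal.eq_top_of_isUnit_mem _ hm h)
      simp [this]
    · obtain ⟨m, hm, ham⟩ := exists_max_ideal_of_mem_nonunits h
      exact (Finset.prod_eq_zero (Finset.mem_univ ⟨m, hm⟩) (by simp [ham])).symm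
  rw [hprod, Finset.prod_one_add, Finset.powerset_univ]
  refine Finset.sum_congr rfl fun S _ => ?_
  by_cases h : ∀ m ∈ S, a ∈ m.asIdeal
  · rw [if_pos (by simpa [Submodule.mem_finsetInf] using h), mul_one,
      Finset.prod_congr rfl fun m hm => if_pos (h m hm), Finset.prod_const]
  · rw [if_neg (by simpa [Submodule.mem_finsetInf] using h), mul_zero]
    push Not at h
    obtain ⟨m, hm, ham⟩ := h
    exact Finset.prod_eq_zero hm (if_neg ham)

/-- In an Artinian ring a finite set of maximal ideals has zero intersection exactly when the ring
is reduced and the set contains every maximal ideal. -/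
lemma MaximalSpectrum.finset_inf_eq_bot_iff {R : Type*} [CommRing R] [IsArtinianRing R]
    [Fintype (MaximalSpectrum R)] (S : Finset (MaximalSpectrum R)) :
    S.inf MaximalSpectrum.asIdeal = ⊥ ↔ IsReduced R ∧ S = Finset.univ := by
  have hinf : Finset.univ.inf MaximalSpectrum.asIdeal = nilradical R := by
    rw [IsArtinianRing.nilradical_eq_iInf, Finset.inf_univ_eq_iInf]
  constructor
  · intro h
    have hS : S = Finset.univ := by
      refine Finset.eq_univ_of_forall fun m => ?_
      obtain ⟨m', hm', hle⟩ := (m.isMaximal.isPrime.inf_le').1 (h.le.trans bot_le)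
      have := m'.isMaximal.eq_of_le m.isMaximal.ne_top hle
      rwa [← MaximalSpectrum.ext this]
    refine ⟨?_, hS⟩
    rw [hS, hinf] at h
    exact nilradical_eq_bot_iff.1 h
  · rintro ⟨h, rfl⟩
    rw [hinf]
    exact nilradical_eq_zero R

open Classical in
/-- The sum over the units of a finite ring of an additive character that is nontrivial on every
nonzero ideal. -/
theorem AddChar.sum_units_eq {R : Type*} [CommRing R] [Finite R] [Fintype Rˣ] (χ : AddChar R ℂ)
    (hχ : ∀ I : Ideal R, (∀ a ∈ I, χ a = 1) → I = ⊥) :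
    ∑ a : Rˣ, χ a = if IsReduced R then (-1) ^ Nat.card (MaximalSpectrum R) else 0 := by
  have := Fintype.ofFinite R
  have := Fintype.ofFinite (MaximalSpectrum R)
  have h1 : ∑ a : Rˣ, χ a = ∑ a : R, (if IsUnit a then 1 else 0) * χ a := by
    simp only [ite_mul, one_mul, zero_mul]
    rw [← Finset.sum_filter]
    refine Finset.sum_bij (fun a _ => (a : R)) (fun a _ => by simp)
      (fun a _ b _ h => Units.ext h) (fun b hb => ?_) (fun _ _ => rfl)
    obtain ⟨u, rfl⟩ := (Finset.mem_filter.1 hb).2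
    exact ⟨u, Finset.mem_univ _, rfl⟩
  have h2 (I : Ideal R) : ∑ a : R, (if a ∈ I then χ a else 0) = if I = ⊥ then 1 else 0 := by
    split_ifs with hI
    · subst hI
      simp
    · refine χ.sum_indicator_ideal I ?_
      by_contra! h
      exact hI (hχ I h)
  calc ∑ a : Rˣ, χ a
      = ∑ S : Finset (MaximalSpectrum R), (-1) ^ S.card *
          ∑ a : R, (if a ∈ S.inf MaximalSpectrum.asIdeal then χ a else 0) := by
        rw [h1]
        simp only [ite_isUnit_eq_sum, Finset.sum_mul, Finset.mul_sum]
        rw [Finset.sum_comm]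
        simp only [mul_assoc, ite_mul, one_mul, zero_mul]
    _ = _ := by
        simp only [h2, MaximalSpectrum.finset_inf_eq_bot_iff]
        split_ifs with h
        · simp [h, Nat.card_eq_fintype_card]
        · simp [h]

/-- Units lift along surjections from an Artinian ring. -/
theorem IsArtinianRing.units_map_surjective {R S : Type*} [CommRing R] [IsArtinianRing R]
    [CommRing S] (π : R →+* S) (hπ : Function.Surjective π) :
    Function.Surjective (Units.map (π : R →* S)) := by
  classical
  intro v
  have := Fintype.ofFinite (MaximalSpectrum R)
  obtain ⟨u, hu⟩ := hπ v
  obtain ⟨w, hw⟩ := hπ (v⁻¹ : Sˣ)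
  let A : Finset (MaximalSpectrum R) := Finset.univ.filter fun m => u ∈ m.asIdeal
  let B : Finset (MaximalSpectrum R) := Finset.univ.filter fun m => u ∉ m.asIdeal
  let K : Ideal R := RingHom.ker π ⊓ B.inf MaximalSpectrum.asIdeal
  have hK : ¬ (K : Set R) ⊆ ⋃ m ∈ (A : Set (MaximalSpectrum R)), (m.asIdeal : Set R) := by
    intro hsub
    obtain ⟨m₀, -, -⟩ := Set.mem_iUnion₂.1 (hsub K.zero_mem)
    have := (Ideal.subset_union_prime_finite A.finite_toSet (f := MaximalSpectrum.asIdeal)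
      m₀ m₀ (fun m _ _ _ => m.isMaximal.isPrime)).1 hsub
    obtain ⟨m, hm, hle⟩ := this
    have hum : u ∈ m.asIdeal := (Finset.mem_filter.1 hm).2
    rcases m.isMaximal.isPrime.inf_le.1 hle with h | h
    · have : 1 - u * w ∈ m.asIdeal := h (by simp [RingHom.mem_ker, hu, hw])
      apply m.isMaximal.ne_top
      rw [Ideal.eq_top_iff_one]
      simpa using m.asIdeal.add_mem this (m.asIdeal.mul_mem_right w hum)
    · obtain ⟨m', hm', hle'⟩ := (m.isMaximal.isPrime.inf_le').1 h
      have := MaximalSpectrum.ext (m'.isMaximal.eq_of_le m.isMaximal.ne_top hle')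
      exact (Finset.mem_filter.1 hm').2 (this ▸ hum)
  obtain ⟨j, hj, hjA⟩ := Set.not_subset.1 hK
  have hunit : IsUnit (u + j) := by
    by_contra h
    obtain ⟨m, hm, hum⟩ := exists_max_ideal_of_mem_nonunits h
    by_cases hu' : u ∈ m
    · refine hjA (Set.mem_biUnion (x := (⟨m, hm⟩ : MaximalSpectrum R)) ?_ ?_)
      · simpa [A] using hu'
      · exact (m.add_mem_iff_right hu').1 hum
    · refine hu' ((m.add_mem_iff_left ?_).1 hum)
      have := (Submodule.mem_finsetInf.1 hj.2) ⟨m, hm⟩ (by simpa [B] using hu')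
      exact this
  refine ⟨hunit.unit, Units.ext ?_⟩
  have : π j = 0 := hj.1
  simp [this, hu]

/-- If `π : R → S` is surjective with kernel the annihilator of `d`, then multiplication by `d`
transports a character nontrivial on nonzero ideals of `R` to one of `S`. -/
lemma AddChar.exists_descend {R S : Type*} [CommRing R] [CommRing S] (π : R →+* S)
    (hπ : Function.Surjective π) (d : R) (hker : ∀ a, π a = 0 ↔ d * a = 0) (χ : AddChar R ℂ)
    (hχ : ∀ I : Ideal R, (∀ a ∈ I, χ a = 1) → I = ⊥) :
    ∃ χ' : AddChar S ℂ, (∀ a, χ' (π a) = χ (d * a)) ∧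
      ∀ I : Ideal S, (∀ a ∈ I, χ' a = 1) → I = ⊥ := by
  have hwd (a b : R) (h : π a = π b) : d * a = d * b := by
    rw [← sub_eq_zero, ← mul_sub, ← hker, map_sub, h, sub_self]
  have hinv (b : S) : π (Function.surjInv hπ b) = b := Function.surjInv_eq hπ b
  let χ' : AddChar S ℂ :=
    { toFun := fun b => χ (d * Function.surjInv hπ b)
      map_zero_eq_one' := by rw [(hker _).1 (hinv 0), AddChar.map_zero_eq_one]
      map_add_eq_mul' := fun a b => by
        rw [← AddChar.map_add_eq_mul, ← mul_add]
        exact congrArg χ (hwd _ _ (by simp [hinv])) }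
  have hχ' (a : R) : χ' (π a) = χ (d * a) := congrArg χ (hwd _ _ (hinv _))
  refine ⟨χ', hχ', fun I hI => ?_⟩
  have hJ : Ideal.span {d} * I.comap π = ⊥ := by
    refine hχ _ fun a ha => ?_
    obtain ⟨b, hb, rfl⟩ := Ideal.mem_span_singleton_mul.1 ha
    rw [← hχ']
    exact hI _ hb
  rw [eq_bot_iff]
  intro b hb
  obtain ⟨a, rfl⟩ := hπ b
  have : d * a ∈ Ideal.span {d} * I.comap π :=
    Ideal.mem_span_singleton_mul.2 ⟨a, hb, rfl⟩
  rw [hJ] at this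
  exact (hker a).2 this

/-- Summing a pulled back function along a surjective homomorphism of finite groups. -/
lemma MonoidHom.sum_comp_of_surjective {G H : Type*} [Group G] [Group H] [Fintype G] [Fintype H]
    (π : G →* H) (hπ : Function.Surjective π) (F : H → ℂ) :
    ∑ a, F (π a) = (Nat.card G / Nat.card H : ℕ) * ∑ b, F b := by
  classical
  have hfib (b : H) : (Finset.univ.filter fun a => π a = b).card = Nat.card π.ker := by
    rw [MonoidHom.card_fiber_eq_of_mem_range π (hπ b) ⟨1, map_one π⟩, Nat.card_eq_fintype_card,
      Fintype.card_subtype]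
    simp only [MonoidHom.mem_ker]
  have hcard : Nat.card G / Nat.card H = Nat.card π.ker := by
    have h1 := π.ker.index_mul_card
    rw [Subgroup.index_ker, MonoidHom.range_eq_top.2 hπ, Subgroup.card_top] at h1
    rw [← h1, Nat.mul_div_cancel_left _ Nat.card_pos]
  rw [hcard, Finset.mul_sum, ← Finset.sum_fiberwise Finset.univ π]
  refine Finset.sum_congr rfl fun b _ => ?_
  rw [Finset.sum_congr rfl fun a ha => congrArg F (Finset.mem_filter.1 ha).2, Finset.sum_const,
    hfib, nsmul_eq_mul]

open Classical in
/-- A Ramanujan sum formula over finite commutative rings: `π : R → S` is a surjection whose kernel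
is the annihilator of `d`, and the sum is taken at `d * c` with `π c` a unit. -/
theorem AddChar.sum_units_mul_eq {R S : Type*} [CommRing R] [Finite R] [CommRing S] [Finite S]
    [Fintype Rˣ] (π : R →+* S) (hπ : Function.Surjective π) (d c : R)
    (hker : ∀ a, π a = 0 ↔ d * a = 0) (hc : IsUnit (π c)) (χ : AddChar R ℂ)
    (hχ : ∀ I : Ideal R, (∀ a ∈ I, χ a = 1) → I = ⊥) :
    ∑ a : Rˣ, χ (d * c * a) = (Nat.card Rˣ / Nat.card Sˣ : ℕ) *
      if IsReduced S then (-1) ^ Nat.card (MaximalSpectrum S) else 0 := by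
  have := Fintype.ofFinite Sˣ
  obtain ⟨χ', hχ', hprim⟩ := χ.exists_descend π hπ d hker hχ
  obtain ⟨v, hv⟩ := hc
  rw [← χ'.sum_units_eq hprim, ← Equiv.sum_comp (Equiv.mulLeft v) fun b : Sˣ => χ' b,
    ← MonoidHom.sum_comp_of_surjective (Units.map (π : R →* S))
      (IsArtinianRing.units_map_surjective π hπ)]
  refine Finset.sum_congr rfl fun a _ => ?_
  simp [mul_assoc, ← hχ', hv]

lemma AdjoinRoot.isReduced_iff_squarefree {K : Type*} [Field K] {t : Polynomial K} (ht : t ≠ 0) :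
    IsReduced (AdjoinRoot t) ↔ Squarefree t := by
  rw [← isRadical_iff_squarefree_of_ne_zero ht, isRadical_iff_span_singleton,
    Ideal.isRadical_iff_quotient_reduced]
  rfl

/-- The maximal ideals of `K[x]/(t)` correspond to the monic irreducible factors of `t`. -/
lemma AdjoinRoot.card_maximalSpectrum {K : Type*} [Field K] {t : Polynomial K} (ht : t ≠ 0) :
    Nat.card (MaximalSpectrum (AdjoinRoot t)) =
      Nat.card {π : Polynomial K // π.Monic ∧ Irreducible π ∧ π ∣ t} := by
  classical
  have hker : RingHom.ker (AdjoinRoot.mk t) = Ideal.span {t} := Ideal.mk_ker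
  have hcomap (π : Polynomial K) (h : π ∣ t) :
      ((Ideal.span {π}).map (AdjoinRoot.mk t)).comap (AdjoinRoot.mk t) = Ideal.span {π} := by
    rw [Ideal.comap_map_of_surjective' _ AdjoinRoot.mk_surjective, hker, sup_eq_left,
      Ideal.span_singleton_le_span_singleton]
    exact h
  have hmax (π : Polynomial K) (hπ : Irreducible π) (h : π ∣ t) :
      ((Ideal.span {π}).map (AdjoinRoot.mk t)).IsMaximal := by
    have := PrincipalIdealRing.isMaximal_of_irreducible hπ
    refine (Ideal.map_eq_top_or_isMaximal_of_surjective _ AdjoinRoot.mk_surjective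
      this).resolve_left fun htop => ?_
    have h2 := hcomap π h
    rw [htop, Ideal.comap_top] at h2
    exact this.ne_top h2.symm
  symm
  refine Nat.card_eq_of_bijective
    (fun π : {π : Polynomial K // π.Monic ∧ Irreducible π ∧ π ∣ t} =>
      (⟨_, hmax π π.2.2.1 π.2.2.2⟩ : MaximalSpectrum (AdjoinRoot t))) ⟨?_, ?_⟩
  · rintro ⟨π, hm, hi, hd⟩ ⟨ρ, hm', hi', hd'⟩ h
    have h1 := congrArg (fun m => Ideal.comap (AdjoinRoot.mk t) m.asIdeal) h
    simp only [hcomap _ hd, hcomap _ hd'] at h1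
    rw [Ideal.span_singleton_eq_span_singleton] at h1
    exact Subtype.ext (Polynomial.eq_of_monic_of_associated hm hm' h1)
  · rintro ⟨m, hm⟩
    have hM : (m.comap (AdjoinRoot.mk t)).IsMaximal :=
      Ideal.comap_isMaximal_of_surjective _ AdjoinRoot.mk_surjective
    obtain ⟨π, hπ⟩ := (IsPrincipalIdealRing.principal (m.comap (AdjoinRoot.mk t))).principal
    rw [Ideal.submodule_span_eq] at hπ
    have hdvd : π ∣ t := by
      rw [← Ideal.mem_span_singleton, ← hπ, Ideal.mem_comap, AdjoinRoot.mk_self]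
      exact m.zero_mem
    have hπ0 : π ≠ 0 := ne_zero_of_dvd_ne_zero ht hdvd
    have hassoc : Associated π (normalize π) := (normalize_associated π).symm
    have hirr : Irreducible π := by
      rw [hπ] at hM
      exact ((Ideal.span_singleton_prime hπ0).1 hM.isPrime).irreducible
    refine ⟨⟨normalize π, Polynomial.monic_normalize hπ0, hassoc.irreducible hirr,
      hassoc.symm.dvd.trans hdvd⟩, MaximalSpectrum.ext ?_⟩
    simp only
    rw [← Ideal.span_singleton_eq_span_singleton.2 hassoc, ← hπ,
      Ideal.map_comap_of_surjective _ AdjoinRoot.mk_surjective]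

lemma AdjoinRoot.finite_of_ne_zero {K : Type*} [Field K] [Finite K] {t : Polynomial K}
    (ht : t ≠ 0) : Finite (AdjoinRoot t) :=
  have : Module.Finite K (AdjoinRoot t) := (AdjoinRoot.powerBasis ht).finite
  Module.finite_of_finite K

open Classical in
lemma muPoly_eq {K : Type} [Field K] [Fintype K] {t : Polynomial K} (ht : t ≠ 0) :
    muPoly t = if IsReduced (AdjoinRoot t) then
      (-1) ^ Nat.card (MaximalSpectrum (AdjoinRoot t)) else 0 := by
  rw [muPoly, omegaPoly, AdjoinRoot.card_maximalSpectrum ht]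
  simp only [AdjoinRoot.isReduced_iff_squarefree ht]

/-- The additive character `a ↦ ζ ^ Tr (ψ a)` attached to a non-degenerate functional is nontrivial
on every nonzero ideal. -/
lemma exists_addChar_of_nondegenerate {K R : Type*} [Field K] [Finite K] [CommRing R] [Algebra K R]
    (p : ℕ) [Fact p.Prime] [Algebra (ZMod p) K] (ψ : R →ₗ[K] K)
    (hψ : ∀ I : Ideal R, (∀ a ∈ I, ψ a = 0) → I = ⊥) (ζ : ℂ) (hζ : IsPrimitiveRoot ζ p) :
    ∃ χ : AddChar R ℂ, (∀ a, χ a = ζ ^ (Algebra.trace (ZMod p) K (ψ a)).val) ∧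
      ∀ I : Ideal R, (∀ a ∈ I, χ a = 1) → I = ⊥ := by
  let χ : AddChar R ℂ := (AddChar.zmodChar p hζ.pow_eq_one).compAddMonoidHom
    ((Algebra.trace (ZMod p) K).toAddMonoidHom.comp ψ.toAddMonoidHom)
  have hχ (a : R) : χ a = ζ ^ (Algebra.trace (ZMod p) K (ψ a)).val := rfl
  refine ⟨χ, hχ, fun I hI => hψ I fun a ha => ?_⟩
  by_contra h
  have : Module.Finite (ZMod p) K := Module.Finite.of_finite
  obtain ⟨y, hy⟩ := Algebra.trace_surjective (ZMod p) K 1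
  have hmem : (y / ψ a) • a ∈ I := I.smul_of_tower_mem _ ha
  have h1 := hI _ hmem
  have : Fact (1 < p) := ⟨(Fact.out : p.Prime).one_lt⟩
  rw [hχ, map_smul, smul_eq_mul, div_mul_cancel₀ _ h, hy, ZMod.val_one, pow_one] at h1
  exact hζ.ne_one (Fact.out : p.Prime).one_lt h1

/-- The Ramanujan sum `c_ψ(g, f) = Σ_{a ∈ (𝔽_q[x]/(f))^×} ζ_p^{Tr(ψ(g·a))}` equals
`μ(t)·φ(f)/φ(t)` where `t = f / gcd(f, g)`, for any non-degenerate `𝔽_q`-linear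
functional `ψ` on `𝔽_q[x]/(f)`.  In particular, it is an integer independent of `ψ`. -/
theorem ramanujan_sum_eq
    (p : ℕ) (hp : p.Prime) [CharP Fq p] [Algebra (ZMod p) Fq]
    (f : Polynomial Fq) (hf : f.Monic) (hdeg : 0 < f.natDegree)
    (g : Polynomial Fq) (hg : g.Monic)
    [Fintype (AdjoinRoot f)ˣ]
    (ψ : AdjoinRoot f →ₗ[Fq] Fq)
    (hψ : ∀ I : Ideal (AdjoinRoot f), (∀ a ∈ I, ψ a = 0) → I = ⊥)
    (ζ : ℂ) (hζ : IsPrimitiveRoot ζ p) :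
    ∑ a : (AdjoinRoot f)ˣ,
        ζ ^ (Algebra.trace (ZMod p) Fq (ψ (AdjoinRoot.mk f g * (a : AdjoinRoot f)))).val =
      (muPoly (f / gcd f g) : ℂ) * (phiPoly f : ℂ) / (phiPoly (f / gcd f g) : ℂ) ∧
    ∃ n : ℤ,
      ∑ a : (AdjoinRoot f)ˣ,
          ζ ^ (Algebra.trace (ZMod p) Fq (ψ (AdjoinRoot.mk f g * (a : AdjoinRoot f)))).val =
        (n : ℂ) := by
  classical
  have : Fact p.Prime := ⟨hp⟩
  have hf0 : f ≠ 0 := hf.ne_zero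
  obtain ⟨χ, hχ, hprim⟩ := exists_addChar_of_nondegenerate p ψ hψ ζ hζ
  set d := gcd f g with hd
  set t := f / d with ht
  have hfd : f = d * t := (EuclideanDomain.mul_div_cancel' (gcd_ne_zero_of_left hf0)
    (gcd_dvd_left f g)).symm
  have hd0 : d ≠ 0 := gcd_ne_zero_of_left hf0
  obtain ⟨c, hc⟩ : d ∣ g := gcd_dvd_right f g
  clear_value t d
  have ht0 : t ≠ 0 := fun h => hf0 (by rw [hfd, h, mul_zero])
  have hcop : IsCoprime t c := by
    rw [← isRelPrime_iff_isCoprime, ← gcd_isUnit_iff_isRelPrime]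
    exact isUnit_gcd_of_eq_mul_gcd (by rwa [← hd]) (by rwa [← hd])
      (by rwa [← hd])
  have := AdjoinRoot.finite_of_ne_zero hf0
  have := AdjoinRoot.finite_of_ne_zero ht0
  let π : AdjoinRoot f →+* AdjoinRoot t := Ideal.Quotient.factor
    (Ideal.span_singleton_le_span_singleton.2 ⟨d, by rw [mul_comm, ← hfd]⟩)
  have hπmk (a : Polynomial Fq) : π (AdjoinRoot.mk f a) = AdjoinRoot.mk t a := rfl
  have hπ : Function.Surjective π := fun b => by
    obtain ⟨a, rfl⟩ := AdjoinRoot.mk_surjective b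
    exact ⟨_, hπmk a⟩
  have hker (a : AdjoinRoot f) : π a = 0 ↔ AdjoinRoot.mk f d * a = 0 := by
    obtain ⟨a, rfl⟩ := AdjoinRoot.mk_surjective a
    rw [hπmk, ← map_mul, AdjoinRoot.mk_eq_zero, AdjoinRoot.mk_eq_zero]
    conv_rhs => rw [hfd]
    rw [mul_dvd_mul_iff_left hd0]
  have hunit : IsUnit (π (AdjoinRoot.mk f c)) := by
    obtain ⟨u, v, huv⟩ := hcop
    refine IsUnit.of_mul_eq_one (AdjoinRoot.mk t v) ?_
    have := congrArg (AdjoinRoot.mk t) huv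
    simpa [hπmk, mul_comm] using this
  have hsum := χ.sum_units_mul_eq π hπ _ _ hker hunit hprim
  have hdvd : phiPoly t ∣ phiPoly f := Subgroup.card_dvd_of_surjective _
    (IsArtinianRing.units_map_surjective π hπ)
  have hpos : (phiPoly t : ℂ) ≠ 0 := Nat.cast_ne_zero.2 Nat.card_pos.ne'
  have hmain : ∑ a : (AdjoinRoot f)ˣ,
      ζ ^ (Algebra.trace (ZMod p) Fq (ψ (AdjoinRoot.mk f g * (a : AdjoinRoot f)))).val =
      (phiPoly f / phiPoly t : ℕ) * (muPoly t : ℂ) := by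
    simp only [← hχ]
    rw [hc, map_mul, hsum, muPoly_eq ht0]
    push_cast
    rfl
  refine ⟨?_, (phiPoly f / phiPoly t : ℕ) * muPoly t, ?_⟩
  · rw [hmain, Nat.cast_div hdvd hpos]
    ring
  · rw [hmain]
    push_cast
    rfl
end

section
/- Let f ∈ 𝔽_q[x] be a nonconstant monic polynomial and D = {f_1, …, f_k} a set of monic proper divisors of f. Then the set of eigenvalues of the adjacency matrix (over ℂ) of the gcd-graph G_f(D) equals { Σ_{i=1}^k μ(t_i(g)) · φ(f/f_i)/φ(t_i(g)) : g ∈ 𝔽_q[x]/(f) }, where for a representative ĝ ∈ 𝔽_q[x] of g one sets t_i(g) = (f/f_i)/gcd(f/f_i, ĝ) (this is independent of the representative since f/f_i divides f). In particular, every eigenvalue of G_f(D) is an integer. -/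
open Polynomial

variable {Fq : Type} [Field Fq] [Fintype Fq] [DecidableEq Fq]

/-- The value `μ(t)·φ(h)/φ(t)` of the Ramanujan sum `c(g, h)`, where `t = h / gcd(h, g)`. -/
noncomputable def ramanujanValue (h g : Polynomial Fq) : ℂ :=
  (muPoly (h / gcd h g) : ℂ) * (phiPoly h : ℂ) / (phiPoly (h / gcd h g) : ℂ)

open UniqueFactorizationMonoid

namespace AddChar

/-- An additive character of the polynomial ring is primitive modulo `h` if `(h)` is the largest
ideal contained in its kernel. -/
def IsPrimitiveMod {K : Type*} [Field K] (Ψ : AddChar K[X] ℂ) (h : K[X]) : Prop :=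
  ∀ p, h ∣ p ↔ ∀ q, Ψ (p * q) = 1

section

variable {K : Type*} [Field K] {Ψ : AddChar K[X] ℂ} {h : K[X]}

lemma IsPrimitiveMod.mulShift {d g : K[X]} (hΨ : Ψ.IsPrimitiveMod h)
    (hd : ∀ p, d ∣ p ↔ h ∣ g * p) : (Ψ.mulShift g).IsPrimitiveMod d := fun p ↦ by
  simp only [hd p, hΨ (g * p), mulShift_apply, mul_assoc]

/-- A character of `K[X]` that is primitive modulo `h` descends to a primitive character of
`K[X]/(h)`. -/
lemma IsPrimitiveMod.exists_lift (hΨ : Ψ.IsPrimitiveMod h) :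
    ∃ ψ : AddChar (AdjoinRoot h) ℂ, ψ.IsPrimitive ∧ ∀ p, ψ (AdjoinRoot.mk h p) = Ψ p := by
  have hs := AdjoinRoot.mk_surjective (g := h)
  have key : ∀ p q, AdjoinRoot.mk h p = AdjoinRoot.mk h q → Ψ p = Ψ q := fun p q hpq ↦ by
    have h1 := (hΨ (p - q)).1 (AdjoinRoot.mk_eq_mk.1 hpq) 1
    rw [mul_one] at h1
    rw [← sub_add_cancel p q, map_add_eq_mul, h1, one_mul]
  have hout := Function.surjInv_eq hs
  let ψ : AddChar (AdjoinRoot h) ℂ :=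
    { toFun := fun x ↦ Ψ (Function.surjInv hs x)
      map_zero_eq_one' := by rw [key _ 0 (by rw [hout, map_zero]), map_zero_eq_one]
      map_add_eq_mul' := fun a b ↦ by
        rw [← map_add_eq_mul]
        exact key _ _ (by rw [map_add, hout, hout, hout]) }
  have hψ : ∀ p, ψ (AdjoinRoot.mk h p) = Ψ p := fun p ↦ key _ _ (hout _)
  refine ⟨ψ, fun a ha h1 ↦ ha ?_, hψ⟩
  obtain ⟨p, rfl⟩ := hs a
  refine AdjoinRoot.mk_eq_zero.2 ((hΨ p).2 fun q ↦ ?_)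
  rw [← hψ, map_mul, ← mulShift_apply, h1, one_apply]

lemma IsPrimitive.isPrimitiveMod {ψ : AddChar (AdjoinRoot h) ℂ} (hψ : ψ.IsPrimitive) :
    (ψ.compAddMonoidHom (AdjoinRoot.mk h : K[X] →+ AdjoinRoot h)).IsPrimitiveMod h := fun p ↦ by
  rw [← AdjoinRoot.mk_eq_zero]
  simp only [compAddMonoidHom_apply, AddMonoidHom.coe_coe, map_mul]
  refine ⟨fun hp q ↦ by rw [hp, zero_mul, map_zero_eq_one], fun H ↦ ?_⟩
  by_contra hp
  refine hψ hp (DFunLike.ext _ _ fun x ↦ ?_)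
  obtain ⟨q, rfl⟩ := AdjoinRoot.mk_surjective x
  simpa using H q

end

/-- The composition of a primitive character of `K` with the coefficient of `X ^ (deg f - 1)` of the
remainder modulo `f`. -/
lemma exists_isPrimitive_adjoinRoot {K : Type*} [Field K] [Finite K] {f : K[X]} (hf : f.Monic)
    (hdeg : 0 < f.natDegree) : ∃ ψ : AddChar (AdjoinRoot f) ℂ, ψ.IsPrimitive := by
  let e := FiniteField.primitiveChar_to_Complex K
  have he : e.IsPrimitive := FiniteField.primitiveChar_to_Complex_isPrimitive K
  let l : K[X] →ₗ[K] K := lcoeff K (f.natDegree - 1) ∘ₗ modByMonicHom f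
  have hl : ∀ p, l p = (p %ₘ f).coeff (f.natDegree - 1) := fun p ↦ rfl
  let Ψ : AddChar K[X] ℂ := e.compAddMonoidHom l.toAddMonoidHom
  have hΨ : ∀ p, Ψ p = e (l p) := fun p ↦ rfl
  suffices h : Ψ.IsPrimitiveMod f from h.exists_lift.imp fun _ h ↦ h.1
  refine fun p ↦ ⟨fun hp q ↦ ?_, fun H ↦ ?_⟩
  · rw [hΨ, hl, (modByMonic_eq_zero_iff_dvd hf).2 (hp.mul_right q), coeff_zero, map_zero_eq_one]
  rw [← modByMonic_eq_zero_iff_dvd hf]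
  by_contra hr
  set r := p %ₘ f with hrdef
  have hrf : r.natDegree < f.natDegree := natDegree_modByMonic_lt p hf (by rintro rfl; simp at hdeg)
  obtain ⟨k, hk⟩ : ∃ k, f.natDegree - 1 = r.natDegree + k :=
    ⟨f.natDegree - 1 - r.natDegree, by omega⟩
  have hval : l (p * X ^ k) = r.leadingCoeff := by
    have h1 : (p * X ^ k) %ₘ f = r * X ^ k := by
      have h2 : (p * X ^ k) %ₘ f = (r * X ^ k) %ₘ f := by
        rw [← sub_eq_zero, ← sub_modByMonic, modByMonic_eq_zero_iff_dvd hf, ← sub_mul]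
        refine Dvd.dvd.mul_right ?_ _
        rw [← modByMonic_eq_zero_iff_dvd hf, sub_modByMonic, hrdef, sub_eq_zero]
        exact ((modByMonic_eq_self_iff hf).2 (degree_modByMonic_lt _ hf)).symm
      rw [h2, modByMonic_eq_self_iff hf]
      refine degree_lt_degree ?_
      rw [natDegree_mul_X_pow _ hr]
      omega
    rw [hl, h1, hk, coeff_mul_X_pow]
    rfl
  refine he (leadingCoeff_ne_zero.2 hr) (DFunLike.ext _ _ fun c ↦ ?_)
  have := H (X ^ k * C c)
  rw [hΨ, ← mul_assoc, mul_comm _ (C c), ← smul_eq_C_mul, map_smul, hval, smul_eq_mul] at this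
  rw [mulShift_apply, mul_comm, this, one_apply]

open Classical in
lemma IsPrimitive.sum_multiples {R : Type*} [CommRing R] [Fintype R] {ψ : AddChar R ℂ}
    (hψ : ψ.IsPrimitive) (c : R) :
    ∑ b, (if c ∣ b then ψ b else 0) = if c = 0 then 1 else 0 := by
  split_ifs with hc
  · simp [hc]
  obtain ⟨y, hy⟩ := ne_one_iff.1 (hψ hc)
  rw [mulShift_apply] at hy
  have h := Equiv.sum_comp (Equiv.addLeft (c * y)) fun b ↦ if c ∣ b then ψ b else 0
  simp only [Equiv.coe_addLeft, dvd_add_right (dvd_mul_right c y), map_add_eq_mul] at h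
  simp only [← mul_ite_zero, ← Finset.mul_sum] at h
  exact eq_zero_of_mul_eq_self_left hy h

end AddChar

namespace AdjoinRoot

variable {K : Type*} [Field K]

lemma isUnit_mk_iff_isCoprime {h p : K[X]} : IsUnit (mk h p) ↔ IsCoprime p h := by
  rw [isUnit_iff_exists_inv, mk_surjective.exists]
  refine ⟨fun ⟨q, hq⟩ ↦ ?_, fun ⟨a, b, hab⟩ ↦ ⟨a, ?_⟩⟩
  · rw [← map_mul, ← map_one (mk h), mk_eq_mk] at hq
    obtain ⟨r, hr⟩ := hq
    exact ⟨q, -r, by linear_combination hr⟩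
  · rw [← map_mul, ← map_one (mk h), mk_eq_mk]
    exact ⟨-b, by linear_combination hab⟩

lemma finite_of_ne_zero_s16 [Finite K] {h : K[X]} (hh : h ≠ 0) : Finite (AdjoinRoot h) :=
  have := (powerBasis hh).finite
  Module.finite_of_finite K

lemma algHomOfDvd_mk {h t : K[X]} (hth : t ∣ h) (p : K[X]) :
    algHomOfDvd K h t hth (mk h p) = mk t p := by
  rw [← aeval_eq, ← aeval_algHom_apply, algHomOfDvd_root, aeval_eq]

/-- Reduction of units is surjective between finite quotients of `K[X]`. -/
lemma units_map_algHomOfDvd_surjective {h t : K[X]} (hth : t ∣ h) (hh : h ≠ 0) :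
    Function.Surjective
      (Units.map (algHomOfDvd K h t hth : AdjoinRoot h →* AdjoinRoot t)) := by
  classical
  intro u
  obtain ⟨p, hp⟩ := mk_surjective (u : AdjoinRoot t)
  have hpt : IsCoprime p t := isUnit_mk_iff_isCoprime.1 (hp ▸ u.isUnit)
  let k := ∏ π ∈ (normalizedFactors h).toFinset with ¬ π ∣ p, π
  have hcop : IsCoprime (p + t * k) h := by
    refine isCoprime_of_prime_dvd (fun H ↦ hh H.2) fun π hπ h1 h2 ↦ ?_
    have hnorm : normalize π ∈ (normalizedFactors h).toFinset := by
      rw [Multiset.mem_toFinset, mem_normalizedFactors_iff' hh]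
      exact ⟨(normalize_associated π).symm.irreducible hπ.irreducible, normalize_idem π,
        normalize_dvd_iff.2 h2⟩
    by_cases hπp : π ∣ p
    · rcases hπ.dvd_or_dvd ((dvd_add_right hπp).1 h1) with h3 | h3
      · exact hπ.not_isUnit (hpt.isUnit_of_dvd' hπp h3)
      · obtain ⟨ρ, hρ, hπρ⟩ := hπ.exists_mem_finset_dvd h3
        simp only [Finset.mem_filter, Multiset.mem_toFinset] at hρ
        exact hρ.2 ((hπ.irreducible.associated_of_dvd (irreducible_of_normalized_factor _ hρ.1)
          hπρ).dvd_iff_dvd_left.1 hπp)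
    · refine hπp ((dvd_add_left (Dvd.dvd.mul_left ?_ t)).1 h1)
      refine normalize_dvd_iff.1 (Finset.dvd_prod_of_mem (fun π ↦ π) ?_)
      simp only [Finset.mem_filter, normalize_dvd_iff]
      exact ⟨hnorm, hπp⟩
  refine ⟨(isUnit_mk_iff_isCoprime.2 hcop).unit, Units.ext ?_⟩
  simp [← hp, algHomOfDvd_mk]

end AdjoinRoot

/-- The sum over a finite group of a function pulled back along a surjective homomorphism. -/
lemma MonoidHom.sum_comp_of_surjective_s16 {G H : Type*} [Group G] [Group H] [Fintype G] [Fintype H]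
    (φ : G →* H) (hφ : Function.Surjective φ) :
    ∃ n : ℕ, Nat.card G = n * Nat.card H ∧ ∀ F : H → ℂ, ∑ g, F (φ g) = n * ∑ y, F y := by
  classical
  have hsum : ∀ F : H → ℂ, ∑ g, F (φ g) =
      (Finset.univ.filter (φ · = 1)).card * ∑ y, F y := fun F ↦ by
    rw [← Finset.sum_fiberwise (g := φ), Finset.mul_sum]
    refine Finset.sum_congr rfl fun y _ ↦ ?_
    rw [Finset.sum_congr rfl (g := fun _ ↦ F y) (by simp +contextual), Finset.sum_const,
      nsmul_eq_mul, card_fiber_eq_of_mem_range φ (hφ y) (hφ 1)]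
  refine ⟨_, ?_, hsum⟩
  have := hsum 1
  simp only [Pi.one_apply, Finset.sum_const, Finset.card_univ, nsmul_eq_mul, mul_one] at this
  simp only [Nat.card_eq_fintype_card]
  exact_mod_cast this

section

variable {K : Type} [Field K]

/-- Inclusion-exclusion over the monic irreducible factors of `t`. -/
lemma AddChar.IsPrimitive.sum_units_eq_muPoly {t : K[X]} (ht : t ≠ 0)
    [Fintype (AdjoinRoot t)] [Fintype (AdjoinRoot t)ˣ] {ψ : AddChar (AdjoinRoot t) ℂ}
    (hψ : ψ.IsPrimitive) : ∑ u : (AdjoinRoot t)ˣ, ψ u = muPoly t := by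
  classical
  set P : Finset K[X] := (normalizedFactors t).toFinset with hP
  have hmem : ∀ π, π ∈ P ↔ π.Monic ∧ Irreducible π ∧ π ∣ t := fun π ↦ by
    rw [hP, Multiset.mem_toFinset, mem_normalizedFactors_iff' ht]
    exact ⟨fun ⟨h1, h2, h3⟩ ↦ ⟨h2 ▸ monic_normalize h1.ne_zero, h1, h3⟩,
      fun ⟨h1, h2, h3⟩ ↦ ⟨h2, h1.normalize_eq_self, h3⟩⟩
  have homega : omegaPoly t = P.card := by
    rw [omegaPoly, ← Nat.card_congr (Equiv.subtypeEquivRight hmem), Nat.card_eq_fintype_card,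
      Fintype.card_coe]
  have hprime : ∀ π ∈ P, Prime π := fun π h ↦ ((hmem π).1 h).2.1.prime
  have hnassoc : ∀ π ∈ P, ∀ ρ ∈ P, π ∣ ρ → π = ρ := fun π hπ ρ hρ h ↦
    eq_of_monic_of_associated ((hmem π).1 hπ).1 ((hmem ρ).1 hρ).1
      ((hprime π hπ).irreducible.associated_of_dvd (hprime ρ hρ).irreducible h)
  have hrel : ∀ S ⊆ P, (S : Set K[X]).Pairwise (Function.onFun IsRelPrime id) :=
    fun S hS π hπ ρ hρ hne ↦ (hprime π (hS hπ)).irreducible.isRelPrime_iff_not_dvd.2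
      fun h ↦ hne (hnassoc π (hS hπ) ρ (hS hρ) h)
  have hdvd : ∀ S ⊆ P, ∏ π ∈ S, π ∣ t := fun S hS ↦
    Finset.prod_dvd_of_isRelPrime (hrel S hS) fun π hπ ↦ ((hmem π).1 (hS hπ)).2.2
  have hmk : ∀ c : K[X], c ∣ t → ∀ p, AdjoinRoot.mk t c ∣ AdjoinRoot.mk t p ↔ c ∣ p :=
    fun c hc p ↦ by
      refine ⟨fun ⟨y, hy⟩ ↦ ?_, map_dvd _⟩
      obtain ⟨q, rfl⟩ := AdjoinRoot.mk_surjective y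
      rw [← map_mul, AdjoinRoot.mk_eq_mk] at hy
      exact (dvd_sub_left (dvd_mul_right c q)).1 (hc.trans hy)
  have hunit : ∀ b : AdjoinRoot t, (if IsUnit b then ψ b else 0) =
      ∑ S ∈ P.powerset, (-1) ^ S.card * if AdjoinRoot.mk t (∏ π ∈ S, π) ∣ b then ψ b else 0 := by
    intro b
    obtain ⟨p, rfl⟩ := AdjoinRoot.mk_surjective b
    have h1 : (if IsUnit (AdjoinRoot.mk t p) then (1 : ℂ) else 0) =
        ∏ π ∈ P, (1 + if π ∣ p then -1 else 0) := by
      have h2 : IsUnit (AdjoinRoot.mk t p) ↔ ∀ π ∈ P, ¬ π ∣ p := by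
        rw [AdjoinRoot.isUnit_mk_iff_isCoprime]
        refine ⟨fun h π hπ hp ↦ (hprime π hπ).not_isUnit
          (h.isUnit_of_dvd' hp ((hmem π).1 hπ).2.2), fun h ↦ ?_⟩
        refine isCoprime_of_prime_dvd (fun H ↦ ht H.2) fun π hπ hp h2 ↦
          h (normalize π) ((hmem _).2 ⟨monic_normalize hπ.ne_zero, ?_, ?_⟩) ?_
        · exact (normalize_associated π).symm.irreducible hπ.irreducible
        · rwa [normalize_dvd_iff]
        · rwa [normalize_dvd_iff]
      split_ifs with h
      · rw [Finset.prod_eq_one]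
        intro π hπ
        rw [if_neg (h2.1 h π hπ), add_zero]
      · rw [h2] at h
        push Not at h
        obtain ⟨π, hπ, hp⟩ := h
        rw [Finset.prod_eq_zero hπ (by rw [if_pos hp]; norm_num)]
    rw [← mul_one (ψ _), ← mul_ite_zero, h1, Finset.prod_one_add, Finset.mul_sum]
    refine Finset.sum_congr rfl fun S hS ↦ ?_
    rw [Finset.mem_powerset] at hS
    simp only [hmk _ (hdvd S hS), Finset.prod_ite_zero, Finset.prod_const]
    have : (∀ π ∈ S, π ∣ p) ↔ ∏ π ∈ S, π ∣ p :=
      ⟨Finset.prod_dvd_of_isRelPrime (hrel S hS),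
        fun h π hπ ↦ (Finset.dvd_prod_of_mem (fun π ↦ π) hπ).trans h⟩
    simp only [this, mul_ite, mul_zero, mul_one]
    split_ifs <;> ring
  have hsum : ∑ u : (AdjoinRoot t)ˣ, ψ u = ∑ b, if IsUnit b then ψ b else 0 := by
    rw [← Finset.sum_filter]
    exact Finset.sum_nbij (fun u ↦ u) (by simp) (Units.val_injective.injOn)
      (fun b hb ↦ by obtain ⟨u, rfl⟩ := (Finset.mem_filter.1 hb).2; exact ⟨u, by simp, rfl⟩)
      fun _ _ ↦ rfl
  rw [hsum, Finset.sum_congr rfl fun b _ ↦ hunit b, Finset.sum_comm]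
  simp only [← Finset.mul_sum, hψ.sum_multiples, AdjoinRoot.mk_eq_zero]
  have hP_of_dvd : ∀ S ⊆ P, t ∣ ∏ π ∈ S, π → S = P := fun S hS h ↦ by
    refine hS.antisymm fun π hπ ↦ ?_
    obtain ⟨ρ, hρ, h'⟩ := (hprime π hπ).exists_mem_finset_dvd (((hmem π).1 hπ).2.2.trans h)
    rwa [hnassoc π hπ ρ (hS hρ) h']
  have hsq : t ∣ ∏ π ∈ P, π ↔ Squarefree t := by
    refine ⟨fun h ↦ Squarefree.squarefree_of_dvd h ?_, fun h ↦ ?_⟩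
    · exact Finset.squarefree_prod_of_pairwise_isCoprime
        (hrel P subset_rfl)
        fun π hπ ↦ (hprime π hπ).irreducible.squarefree
    · have h1 := (squarefree_iff_nodup_normalizedFactors ht).1 h
      refine (prod_normalizedFactors ht).symm.dvd.trans ?_
      rw [hP, Finset.prod, Multiset.toFinset_val, h1.dedup, Multiset.map_id']
  rw [Finset.sum_eq_single P]
  · simp only [hsq, muPoly, homega]
    split_ifs <;> simp
  · intro S hS hne
    rw [if_neg fun h ↦ hne (hP_of_dvd S (Finset.mem_powerset.1 hS) h), mul_zero]
  · simp

end

/-- The evaluation of Ramanujan sums over `K[X]`. -/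
lemma AddChar.IsPrimitive.sum_units_mul {K : Type} [Field K] [Finite K] [DecidableEq K] {h : K[X]}
    (hh : h ≠ 0) [Fintype (AdjoinRoot h)ˣ] {ψ : AddChar (AdjoinRoot h) ℂ} (hψ : ψ.IsPrimitive)
    (g : K[X]) : ∑ u : (AdjoinRoot h)ˣ, ψ (AdjoinRoot.mk h g * u) = ramanujanValue h g ∧
      ∃ n : ℤ, ramanujanValue h g = n := by
  have hG : gcd h g ≠ 0 := fun H ↦ hh ((gcd_eq_zero_iff _ _).1 H).1
  obtain ⟨t, ht⟩ := gcd_dvd_left h g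
  have htdef : h / gcd h g = t := EuclideanDomain.eq_div_of_mul_eq_right hG ht.symm |>.symm
  have hth : t ∣ h := ⟨_, ht.trans (mul_comm _ _)⟩
  have ht0 : t ≠ 0 := fun H ↦ hh (zero_dvd_iff.1 (H ▸ hth))
  have := AdjoinRoot.finite_of_ne_zero_s16 ht0
  have := Fintype.ofFinite (AdjoinRoot t)
  have := Fintype.ofFinite (AdjoinRoot t)ˣ
  have hdvd : ∀ p, t ∣ p ↔ h ∣ g * p := fun p ↦ by
    obtain ⟨g', hg'⟩ := gcd_dvd_right h g
    have hcop : IsCoprime t g' := by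
      rw [← gcd_isUnit_iff, isUnit_iff_dvd_one, ← mul_dvd_mul_iff_left hG, mul_one]
      refine dvd_gcd ?_ ?_
      · exact (mul_dvd_mul_left _ (gcd_dvd_left t g')).trans ht.symm.dvd
      · exact (mul_dvd_mul_left _ (gcd_dvd_right t g')).trans hg'.symm.dvd
    have : h ∣ g * p ↔ gcd h g * t ∣ gcd h g * (g' * p) := by
      rw [← ht, ← mul_assoc, ← hg']
    rw [this, mul_dvd_mul_iff_left hG, ]
    exact ⟨fun h ↦ h.mul_left _, hcop.dvd_of_dvd_mul_left⟩
  obtain ⟨ψ', hψ', hval⟩ := (hψ.isPrimitiveMod.mulShift hdvd).exists_lift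
  obtain ⟨n, hn, hsum⟩ := (Units.map (AdjoinRoot.algHomOfDvd K h t hth :
    AdjoinRoot h →* AdjoinRoot t)).sum_comp_of_surjective_s16
      (AdjoinRoot.units_map_algHomOfDvd_surjective hth hh)
  have hram : ramanujanValue h g = n * muPoly t := by
    have hpos : (phiPoly t : ℂ) ≠ 0 := Nat.cast_ne_zero.2 Nat.card_pos.ne'
    rw [ramanujanValue, htdef, div_eq_iff hpos]
    have : phiPoly h = n * phiPoly t := hn
    rw [this]
    push_cast
    ring
  refine ⟨?_, n * muPoly t, by rw [hram]; push_cast; rfl⟩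
  rw [hram, ← hψ'.sum_units_eq_muPoly ht0, ← hsum fun u ↦ ψ' u]
  refine Finset.sum_congr rfl fun u _ ↦ ?_
  obtain ⟨p, hp⟩ := AdjoinRoot.mk_surjective (u : AdjoinRoot h)
  simp [← hp, AdjoinRoot.algHomOfDvd_mk, hval]

section

variable {K : Type} [Field K] [DecidableEq K]

lemma gcd_mul_eq_iff_isCoprime {d a h : K[X]} (hd : d.Monic) :
    gcd (d * a) (d * h) = d ↔ IsCoprime a h := by
  rw [gcd_mul_left, hd.normalize_eq_self, ← gcd_isUnit_iff, mul_eq_left₀ hd.ne_zero,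
    ← normalize_eq_one, normalize_gcd]

lemma exists_mk_eq_sub_and_gcd_mem_iff {f : K[X]} {D : Finset K[X]} {u v : AdjoinRoot f} :
    (∃ p, AdjoinRoot.mk f p = u - v ∧ gcd p f ∈ D) ↔
      ∃ p, AdjoinRoot.mk f p = v - u ∧ gcd p f ∈ D := by
  have key : ∀ u v : AdjoinRoot f, (∃ p, AdjoinRoot.mk f p = u - v ∧ gcd p f ∈ D) →
      ∃ p, AdjoinRoot.mk f p = v - u ∧ gcd p f ∈ D := fun u v ⟨p, hp, hD⟩ ↦ by
    refine ⟨-p, by rw [map_neg, hp, neg_sub], ?_⟩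
    rwa [(Associated.neg_left (Associated.refl p)).gcd_eq_left]
  exact ⟨key u v, key v u⟩

lemma gcdGraph_adj_iff {f : K[X]} (hf : f.Monic) {D : Finset K[X]} (hfD : f ∉ D)
    {u v : AdjoinRoot f} :
    (gcdGraph f D).Adj u v ↔ ∃ p, AdjoinRoot.mk f p = u - v ∧ gcd p f ∈ D := by
  rw [gcdGraph, SimpleGraph.fromRel_adj, ← exists_mk_eq_sub_and_gcd_mem_iff, or_self,
    and_iff_right_iff_imp]
  rintro ⟨p, hp, hD⟩ rfl
  rw [sub_self, AdjoinRoot.mk_eq_zero] at hp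
  rw [← normalize_gcd, normalize_eq_normalize (gcd_dvd_right _ _) (dvd_gcd hp dvd_rfl),
    hf.normalize_eq_self] at hD
  exact hfD hD

lemma gcd_eq_of_mk_eq {f p q : K[X]} (h : AdjoinRoot.mk f p = AdjoinRoot.mk f q) :
    gcd p f = gcd q f := by
  obtain ⟨r, hr⟩ := AdjoinRoot.mk_eq_mk.1 h
  refine dvd_antisymm_of_normalize_eq (normalize_gcd _ _) (normalize_gcd _ _)
    (dvd_gcd ?_ (gcd_dvd_right _ _)) (dvd_gcd ?_ (gcd_dvd_right _ _))
  · rw [show q = p - f * r by rw [← hr]; ring]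
    exact dvd_sub (gcd_dvd_left _ _) ((gcd_dvd_right _ _).mul_right _)
  · rw [show p = q + f * r by rw [← hr]; ring]
    exact dvd_add (gcd_dvd_left _ _) ((gcd_dvd_right _ _).mul_right _)

open Classical in
lemma AddChar.IsPrimitive.sum_gcd_eq [Finite K] {f : K[X]} (hf : f.Monic)
    [Fintype (AdjoinRoot f)] {ψ : AddChar (AdjoinRoot f) ℂ} (hψ : ψ.IsPrimitive) {d : K[X]}
    (hd : d.Monic) (hdf : d ∣ f) (g : K[X]) :
    ∑ w, (if ∃ p, AdjoinRoot.mk f p = w ∧ gcd p f = d then ψ (AdjoinRoot.mk f g * w) else 0) =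
      ramanujanValue (f / d) g ∧ ∃ n : ℤ, ramanujanValue (f / d) g = n := by
  obtain ⟨h, rfl⟩ := hdf
  have hd0 := hd.ne_zero
  have hh : h ≠ 0 := right_ne_zero_of_mul hf.ne_zero
  rw [mul_div_cancel_left₀ h hd0]
  have := AdjoinRoot.finite_of_ne_zero_s16 hh
  have := Fintype.ofFinite (AdjoinRoot h)ˣ
  obtain ⟨ψ', hψ', hval⟩ := (hψ.isPrimitiveMod.mulShift (d := h) (g := d)
    fun p ↦ (mul_dvd_mul_iff_left hd0).symm).exists_lift
  obtain ⟨hsum, hint⟩ := hψ'.sum_units_mul hh g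
  refine ⟨?_, hint⟩
  rw [← hsum, ← Finset.sum_filter]
  have hs := AdjoinRoot.mk_surjective (g := h)
  have hout := Function.surjInv_eq hs
  have hmk : ∀ p q, AdjoinRoot.mk (d * h) (d * p) = AdjoinRoot.mk (d * h) (d * q) ↔
      AdjoinRoot.mk h p = AdjoinRoot.mk h q := fun p q ↦ by
    rw [AdjoinRoot.mk_eq_mk, AdjoinRoot.mk_eq_mk, ← mul_sub, mul_dvd_mul_iff_left hd0]
  symm
  refine Finset.sum_nbij (fun u ↦ AdjoinRoot.mk (d * h) (d * Function.surjInv hs u)) ?_ ?_ ?_ ?_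
  · intro u _
    simp only [Finset.mem_filter, Finset.mem_univ, true_and]
    refine ⟨_, rfl, ?_⟩
    rw [gcd_mul_eq_iff_isCoprime hd, ← AdjoinRoot.isUnit_mk_iff_isCoprime, hout]
    exact u.isUnit
  · intro u _ v _ huv
    simp only [hmk, hout] at huv
    exact Units.ext huv
  · intro w hw
    simp only [Finset.coe_filter, Finset.mem_univ, true_and, Set.mem_ofPred_eq] at hw
    obtain ⟨p, rfl, hp⟩ := hw
    obtain ⟨a, rfl⟩ : d ∣ p := hp ▸ gcd_dvd_left _ _
    rw [gcd_mul_eq_iff_isCoprime hd, ← AdjoinRoot.isUnit_mk_iff_isCoprime] at hp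
    refine ⟨hp.unit, by simp, ?_⟩
    simp only [hmk, hout, IsUnit.unit_spec]
  · intro u _
    conv_lhs => rw [← hout (u : AdjoinRoot h)]
    rw [← map_mul, ← map_mul, hval]
    simp only [mulShift_apply, compAddMonoidHom_apply, AddMonoidHom.coe_coe]
    ring_nf

end

/-- The eigenvalues of a translation-invariant matrix over a finite ring with a primitive additive
character. -/
lemma AddChar.IsPrimitive.exists_mulVec_eq_smul_iff {R : Type*} [CommRing R] [Fintype R]
    {ψ : AddChar R ℂ} (hψ : ψ.IsPrimitive) (s : R → ℂ) (A : Matrix R R ℂ)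
    (hA : ∀ u v, A u v = s (u - v)) (μ : ℂ) :
    (∃ v : R → ℂ, v ≠ 0 ∧ A.mulVec v = μ • v) ↔ ∃ g, μ = ∑ w, s w * ψ (g * w) := by
  classical
  constructor
  · rintro ⟨v, hv, hAv⟩
    by_contra! hμ
    have hzero : ∀ g, ∑ u, v u * ψ (g * u) = 0 := fun g ↦ by
      have h1 : ∑ u, A.mulVec v u * ψ (g * u) =
          (∑ w, s w * ψ (g * w)) * ∑ u, v u * ψ (g * u) := by
        simp only [Matrix.mulVec, dotProduct, Finset.sum_mul, Finset.mul_sum, hA]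
        rw [Finset.sum_comm]
        refine Finset.sum_congr rfl fun x _ ↦ ?_
        refine Fintype.sum_equiv (Equiv.subRight x) _ _ fun u ↦ ?_
        rw [Equiv.subRight_apply, mul_mul_mul_comm, ← map_add_eq_mul, ← mul_add, sub_add_cancel]
      rw [hAv] at h1
      simp only [Pi.smul_apply, smul_eq_mul, mul_assoc, ← Finset.mul_sum] at h1
      exact (mul_eq_mul_right_iff.1 h1).resolve_left (hμ g)
    refine hv (funext fun w ↦ ?_)
    have h2 : ∑ g, (∑ u, v u * ψ (g * u)) * ψ (g * -w) = v w * Fintype.card R := by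
      simp only [Finset.sum_mul, mul_assoc, ← map_add_eq_mul, ← mul_add]
      rw [Finset.sum_comm]
      simp only [← Finset.mul_sum, sum_mulShift _ hψ, add_neg_eq_zero]
      simp
    simpa [hzero] using h2
  · rintro ⟨g, rfl⟩
    refine ⟨fun v ↦ ψ (-(g * v)), fun h ↦ ?_, funext fun u ↦ ?_⟩
    · simpa using congrFun h 0
    · simp only [Matrix.mulVec, dotProduct, hA, Pi.smul_apply, smul_eq_mul, Finset.sum_mul]
      refine Fintype.sum_equiv (Equiv.subLeft u) _ _ fun v ↦ ?_
      rw [Equiv.subLeft_apply, mul_assoc, ← map_add_eq_mul]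
      ring_nf

/-- The set of eigenvalues of the adjacency matrix of the gcd-graph `G_f(D)` is
`{ Σ_{i} c(g, f/f_i) : g ∈ 𝔽_q[x]/(f) }`, where `c(g, h) = μ(t)·φ(h)/φ(t)` with
`t = h / gcd(h, g)`.  In particular, every eigenvalue of `G_f(D)` is an integer. -/
theorem gcdGraph_eigenvalues
    (f : Polynomial Fq) (hf : f.Monic) (hdeg : 0 < f.natDegree)
    (D : Finset (Polynomial Fq)) (hD : ∀ d ∈ D, d.Monic ∧ d ∣ f ∧ d ≠ f)
    [Fintype (AdjoinRoot f)] [DecidableRel (gcdGraph f D).Adj] :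
    {μ : ℂ | ∃ v : AdjoinRoot f → ℂ, v ≠ 0 ∧
        ((gcdGraph f D).adjMatrix ℂ).mulVec v = μ • v} =
      {μ : ℂ | ∃ g : Polynomial Fq, μ = ∑ d ∈ D, ramanujanValue (f / d) g} ∧
    ∀ μ : ℂ,
      (∃ v : AdjoinRoot f → ℂ, v ≠ 0 ∧ ((gcdGraph f D).adjMatrix ℂ).mulVec v = μ • v) →
      ∃ n : ℤ, μ = (n : ℂ) := by
  classical
  obtain ⟨ψ, hψ⟩ := AddChar.exists_isPrimitive_adjoinRoot hf hdeg
  have hfD : f ∉ D := fun h ↦ (hD f h).2.2 rfl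
  have hA : ∀ u v, (gcdGraph f D).adjMatrix ℂ u v =
      ∑ d ∈ D, if ∃ p, AdjoinRoot.mk f p = u - v ∧ gcd p f = d then 1 else 0 := fun u v ↦ by
    obtain ⟨q, hq⟩ := AdjoinRoot.mk_surjective (u - v)
    have key : ∀ P : Polynomial Fq → Prop,
        (∃ p, AdjoinRoot.mk f p = u - v ∧ P (gcd p f)) ↔ P (gcd q f) := fun P ↦
      ⟨fun ⟨p, hp, h⟩ ↦ gcd_eq_of_mk_eq (hp.trans hq.symm) ▸ h, fun h ↦ ⟨q, hq, h⟩⟩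
    simp only [SimpleGraph.adjMatrix_apply, gcdGraph_adj_iff hf hfD, key (· ∈ D),
      fun d ↦ key (· = d), Finset.sum_ite_eq]
  have heig : ∀ μ : ℂ, (∃ v : AdjoinRoot f → ℂ, v ≠ 0 ∧
      ((gcdGraph f D).adjMatrix ℂ).mulVec v = μ • v) ↔
      ∃ g : Polynomial Fq, μ = ∑ d ∈ D, ramanujanValue (f / d) g := fun μ ↦ by
    rw [hψ.exists_mulVec_eq_smul_iff (fun w ↦ ∑ d ∈ D,
      if ∃ p, AdjoinRoot.mk f p = w ∧ gcd p f = d then 1 else 0) _ hA,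
      AdjoinRoot.mk_surjective.exists]
    refine exists_congr fun g ↦ ?_
    simp only [Finset.sum_mul, ite_mul, one_mul, zero_mul]
    rw [Finset.sum_comm, Finset.sum_congr rfl fun d hd ↦
      (hψ.sum_gcd_eq hf (hD d hd).1 (hD d hd).2.1 g).1]
  refine ⟨Set.ext heig, fun μ hμ ↦ ?_⟩
  obtain ⟨g, rfl⟩ := (heig μ).1 hμ
  choose! n hn using fun d hd ↦ (hψ.sum_gcd_eq hf (hD d hd).1 (hD d hd).2.1 g).2
  exact ⟨∑ d ∈ D, n d, by rw [Int.cast_sum]; exact Finset.sum_congr rfl hn⟩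
end
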